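/- arXiv:1912.06296 — 5 statements merged into one kernel-verified Lean document; each statement's English description precedes it below -/
import Mathlib

section
/- Lemma 1 (summable disagreement): suppose in Algorithm 1 that W is symmetric doubly stochastic with ‖W − (1/N)𝟙𝟙ᵀ‖₂ = β < 1, the perturbations are bounded, ‖r^k_{ij}‖ ≤ Δ for all i, j, k, the step sizes α^k > 0 are nonincreasing with ∑_k (α^k)² < ∞, and the action increments satisfy ‖x^{k+1}_i − x^k_i‖ ≤ C α^k for all i and k for some constant C. Then for every player i, ∑_{k=0}^∞ α^k ‖y^k − v̂^k_i‖ < ∞, where y^k = (1/N) ∑_{j=1}^N v_j^k. -/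
/-- `Euc d` is the Euclidean space `ℝ^d`. -/
abbrev Euc (d : ℕ) := EuclideanSpace ℝ (Fin d)

theorem aux_summable (α a : ℕ → ℝ) (β K : ℝ) (hβ1 : β < 1) (hK : 0 ≤ K)
    (hαpos : ∀ k, 0 < α k) (hαmono : Antitone α)
    (hα2 : Summable fun k => (α k) ^ 2) (ha : ∀ k, 0 ≤ a k)
    (hrec : ∀ k, a (k + 1) ≤ β * a k + K * α k) :
    Summable fun k => α k * a k := by
  have hs : ∀ k, 0 ≤ α k * a k := fun k => mul_nonneg (hαpos k).le (ha k)
  apply summable_of_sum_range_le (c := (α 0 * a 0 + K * ∑' k, (α k) ^ 2) / (1 - β)) hs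
  intro n
  have h1 : ∀ k, α (k + 1) * a (k + 1) ≤ β * (α k * a k) + K * (α k) ^ 2 := by
    intro k
    have h := mul_le_mul_of_nonneg_right (hαmono (Nat.le_succ k)) (ha (k + 1))
    have h' := mul_le_mul_of_nonneg_left (hrec k) (hαpos k).le
    simp only [Nat.succ_eq_add_one] at h
    nlinarith
  have h2 : ∑ k ∈ Finset.range n, α (k + 1) * a (k + 1)
      ≤ β * ∑ k ∈ Finset.range n, α k * a k + K * ∑ k ∈ Finset.range n, (α k) ^ 2 := by
    rw [Finset.mul_sum, Finset.mul_sum, ← Finset.sum_add_distrib]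
    exact Finset.sum_le_sum fun k _ => h1 k
  have h3 : ∑ k ∈ Finset.range n, (α k) ^ 2 ≤ ∑' k, (α k) ^ 2 :=
    hα2.sum_le_tsum _ fun k _ => sq_nonneg _
  have h4 := Finset.sum_range_succ (fun k => α k * a k) n
  rw [Finset.sum_range_succ'] at h4
  have h5 := mul_le_mul_of_nonneg_left h3 hK
  have h6 := hs n
  rw [le_div_iff₀ (by linarith)]
  nlinarith

theorem aux_norm_le {n : ℕ} (z : EuclideanSpace ℝ (Fin n)) : ‖z‖ ≤ ∑ i, |z i| := by
  rw [EuclideanSpace.norm_eq]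
  apply Real.sqrt_le_iff.mpr
  refine ⟨Finset.sum_nonneg fun i _ => abs_nonneg _, ?_⟩
  exact Finset.sum_sq_le_sq_sum_of_nonneg fun i _ => abs_nonneg _

theorem aux_apply_le {n : ℕ} (z : EuclideanSpace ℝ (Fin n)) (i : Fin n) : |z i| ≤ ‖z‖ :=
  PiLp.norm_apply_le z i

/-- Lemma 1 (summable disagreement): in Algorithm 1, if the symmetric doubly stochastic
matrix `W` satisfies `‖W − (1/N)𝟙𝟙ᵀ‖₂ = β < 1`, the perturbations are bounded by `Δ`,
the step sizes are positive nonincreasing and square summable, and the action increments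
satisfy `‖x^{k+1}_i − x^k_i‖ ≤ C α^k`, then `∑_k α^k ‖y^k − v̂^k_i‖ < ∞` for every `i`,
where `y^k = (1/N) ∑_j v_j^k`. -/
theorem stmt_4
    (d N : ℕ) (hN : 0 < N)
    (G : SimpleGraph (Fin N)) [DecidableRel G.Adj]
    (W : Matrix (Fin N) (Fin N) ℝ)
    (hWsymm : W.IsSymm)
    (hWrow : ∀ i, ∑ j, W i j = 1)
    (hWcol : ∀ j, ∑ i, W i j = 1)
    (hWnadj : ∀ i j, i ≠ j → ¬ G.Adj i j → W i j = 0)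
    -- spectral norm condition `‖W − (1/N)𝟙𝟙ᵀ‖₂ = β < 1`:
    (β : ℝ)
    (hβ : ‖Matrix.toEuclideanCLM (𝕜 := ℝ)
            (W - Matrix.of fun _ _ : Fin N => (N : ℝ)⁻¹)‖ = β)
    (hβ1 : β < 1)
    -- positive, nonincreasing, square-summable step sizes:
    (α : ℕ → ℝ) (hαpos : ∀ k, 0 < α k) (hαmono : Antitone α)
    (hα2 : Summable fun k => (α k) ^ 2)
    (x v vhat : ℕ → Fin N → Euc d)
    (r : ℕ → Fin N → Fin N → Euc d)
    -- perturbations vanish on the diagonal, are locally balanced, and bounded by `Δ`: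
    (hrdiag : ∀ k i, r k i i = 0)
    (hrbal : ∀ k i, ∑ j ∈ insert i (G.neighborFinset i), r k i j = 0)
    (Δ : ℝ) (hΔ : ∀ k i j, ‖r k i j‖ ≤ Δ)
    -- bounded action increments:
    (C : ℝ) (hC : ∀ k i, ‖x (k + 1) i - x k i‖ ≤ C * α k)
    -- Algorithm 1 updates:
    (hvhat : ∀ k i, vhat k i = ∑ j, W i j • (v k j + α k • r k j i))
    (hvupd : ∀ k i, v (k + 1) i = vhat k i + x (k + 1) i - x k i)
    (hinit : ∀ i, v 0 i = x 0 i) :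
    ∀ i, Summable fun k => α k * ‖(N : ℝ)⁻¹ • (∑ j, v k j) - vhat k i‖ := by
  classical
  have hNR : (N : ℝ) ≠ 0 := by positivity
  set T := Matrix.toEuclideanCLM (𝕜 := ℝ)
            (W - Matrix.of fun _ _ : Fin N => (N : ℝ)⁻¹) with hT
  have hTapp : ∀ (f : Fin N → ℝ) (i : Fin N),
      T (WithLp.toLp 2 f) i = ∑ j, W i j * f j - (N : ℝ)⁻¹ * ∑ j, f j := by
    intro f i
    simp [hT, Matrix.mulVec, dotProduct, sub_mul, Finset.sum_sub_distrib, Finset.mul_sum]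
  -- the perturbation term
  let p : ℕ → Fin N → Euc d := fun k i => ∑ j, W i j • r k j i
  have hvh : ∀ k i, vhat k i = ∑ j, W i j • v k j + α k • p k i := by
    intro k i
    rw [hvhat]
    simp only [p, smul_add, Finset.sum_add_distrib, Finset.smul_sum]
    congr 1
    exact Finset.sum_congr rfl fun j _ => smul_comm _ _ _
  let P : ℝ := ∑ i, ∑ j, |W i j| * |Δ|
  have hp : ∀ k i, ‖p k i‖ ≤ P := by
    intro k i
    calc ‖p k i‖ ≤ ∑ j, ‖W i j • r k j i‖ := norm_sum_le _ _
      _ ≤ ∑ j, |W i j| * |Δ| := by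
        apply Finset.sum_le_sum
        intro j _
        rw [norm_smul, Real.norm_eq_abs]
        exact mul_le_mul_of_nonneg_left ((hΔ k j i).trans (le_abs_self _)) (abs_nonneg _)
      _ ≤ P := Finset.single_le_sum (f := fun i => ∑ j, |W i j| * |Δ|)
        (fun i _ => Finset.sum_nonneg fun j _ => by positivity) (Finset.mem_univ i)
  have hP0 : 0 ≤ P := Finset.sum_nonneg fun i _ => Finset.sum_nonneg fun j _ => by positivity
  let u : ℕ → Fin N → Euc d := fun k i => α k • p k i + (x (k + 1) i - x k i)
  have hu : ∀ k i, ‖u k i‖ ≤ (P + |C|) * α k := by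
    intro k i
    have h1 : ‖α k • p k i‖ ≤ α k * P := by
      rw [norm_smul, Real.norm_eq_abs, abs_of_pos (hαpos k)]
      exact mul_le_mul_of_nonneg_left (hp k i) (hαpos k).le
    have h2 := hC k i
    have h3 := mul_le_mul_of_nonneg_right (le_abs_self C) (hαpos k).le
    have h4 : ‖u k i‖ ≤ _ := norm_add_le (α k • p k i) (x (k + 1) i - x k i)
    linarith
  have hv : ∀ k i, v (k + 1) i = ∑ j, W i j • v k j + u k i := by
    intro k i
    rw [hvupd, hvh]
    simp only [u]
    abel
  let V : ℕ → Fin d → EuclideanSpace ℝ (Fin N) := fun k c => WithLp.toLp 2 fun i => v k i c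
  let U : ℕ → Fin d → EuclideanSpace ℝ (Fin N) := fun k c => WithLp.toLp 2 fun i => u k i c
  let O : EuclideanSpace ℝ (Fin N) := WithLp.toLp 2 fun _ => 1
  have hTO : T O = 0 := by
    ext i
    simp only [O]
    rw [hTapp]
    simp [hWrow, hNR]
  have hV : ∀ k c, V (k + 1) c = T (V k c) + ((N : ℝ)⁻¹ * ∑ j, v k j c) • O + U k c := by
    intro k c
    ext i
    have := hTapp (fun i => v k i c) i
    simp only [V, U, O, PiLp.add_apply, PiLp.smul_apply, this, hv k i]
    simp
  let K : ℝ := ∑ _i : Fin N, (P + |C|)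
  have hK0 : 0 ≤ K := Finset.sum_nonneg fun i _ => by positivity
  have hU : ∀ k c, ‖U k c‖ ≤ K * α k := by
    intro k c
    refine (aux_norm_le _).trans ?_
    rw [Finset.sum_mul]
    exact Finset.sum_le_sum fun i _ => (aux_apply_le (u k i) c).trans (hu k i)
  have hβ0 : 0 ≤ β := hβ ▸ norm_nonneg _
  have hsum : ∀ c, Summable fun k => α k * ‖T (V k c)‖ := by
    intro c
    apply aux_summable α _ β (β * K) hβ1 (by positivity) hαpos hαmono hα2
      (fun k => norm_nonneg _)
    intro k
    rw [hV, map_add, map_add, map_smul, hTO, smul_zero, add_zero]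
    have h1 := T.le_opNorm (T (V k c))
    have h2 := T.le_opNorm (U k c)
    rw [hβ] at h1 h2
    have h3 := mul_le_mul_of_nonneg_left (hU k c) hβ0
    have h4 := norm_add_le (T (T (V k c))) (T (U k c))
    linarith
  intro i
  have hmaj : Summable fun k => ∑ c : Fin d, (α k * ‖T (V k c)‖ + P * (α k) ^ 2) :=
    summable_sum fun c _ => (hsum c).add (hα2.mul_left P)
  refine Summable.of_nonneg_of_le (fun k => mul_nonneg (hαpos k).le (norm_nonneg _)) ?_ hmaj
  intro k
  have hk := (hαpos k).le
  refine (mul_le_mul_of_nonneg_left (aux_norm_le _) hk).trans ?_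
  rw [Finset.mul_sum]
  apply Finset.sum_le_sum
  intro c _
  have hc : ((N : ℝ)⁻¹ • (∑ j, v k j) - vhat k i) c = -(T (V k c) i) - α k * p k i c := by
    have := hTapp (fun i => v k i c) i
    simp only [V, this, hvh k i]
    simp
    ring
  rw [hc]
  have h1 := aux_apply_le (T (V k c)) i
  have h2 := (aux_apply_le (p k i) c).trans (hp k i)
  have h3 : |-(T (V k c) i) - α k * p k i c| ≤ ‖T (V k c)‖ + α k * P := by
    refine (abs_sub _ _).trans ?_
    rw [abs_neg, abs_mul, abs_of_nonneg hk]
    exact add_le_add h1 (mul_le_mul_of_nonneg_left h2 hk)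
  have h4 := mul_le_mul_of_nonneg_left h3 hk
  linarith
end

section
/- Limit extraction lemma: let X ⊆ ℝ^n be compact, x* ∈ X, and Φ : X → ℝ be continuous with Φ(x) > 0 for every x ∈ X with x ≠ x* and Φ(x*) = 0. Let (x^k) be a sequence in X such that ‖x^k − x*‖ converges (to some limit), and let α^k ≥ 0 satisfy ∑_{k=0}^∞ α^k = ∞ and ∑_{k=0}^∞ α^k Φ(x^k) < ∞. Then x^k → x*. -/
open Filter

/-- Limit extraction lemma: if `X ⊆ ℝ^n` is compact, `Φ : X → ℝ` is continuous,
positive away from `x* ∈ X` and zero at `x*`, `(x^k) ⊆ X` has `‖x^k − x*‖` convergent,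
`α^k ≥ 0`, `∑ α^k = ∞` and `∑ α^k Φ(x^k) < ∞`, then `x^k → x*`. -/
theorem stmt_6
    (n : ℕ) (X : Set (EuclideanSpace ℝ (Fin n)))
    (hXcomp : IsCompact X)
    (xs : EuclideanSpace ℝ (Fin n)) (hxs : xs ∈ X)
    (Φ : EuclideanSpace ℝ (Fin n) → ℝ)
    (hΦcont : ContinuousOn Φ X)
    (hΦpos : ∀ x ∈ X, x ≠ xs → 0 < Φ x)
    (hΦzero : Φ xs = 0)
    (x : ℕ → EuclideanSpace ℝ (Fin n)) (hx : ∀ k, x k ∈ X)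
    (hdist : ∃ L : ℝ, Tendsto (fun k => ‖x k - xs‖) atTop (nhds L))
    (α : ℕ → ℝ) (hα : ∀ k, 0 ≤ α k)
    (hαdiv : Tendsto (fun m => ∑ k ∈ Finset.range m, α k) atTop atTop)
    (hsum : Summable fun k => α k * Φ (x k)) :
    Tendsto x atTop (nhds xs) := by
  obtain ⟨L, hL⟩ := hdist
  have hL0 : 0 ≤ L := ge_of_tendsto' hL (fun k => norm_nonneg _)
  rcases hL0.eq_or_lt with h0 | hpos
  · rw [tendsto_iff_norm_sub_tendsto_zero, h0]
    exact hL
  exfalso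
  have hev : ∀ᶠ k in atTop, L / 2 < ‖x k - xs‖ :=
    hL.eventually (lt_mem_nhds (by linarith))
  have hclosed : IsClosed {y : EuclideanSpace ℝ (Fin n) | L / 2 ≤ ‖y - xs‖} :=
    isClosed_le continuous_const (by fun_prop)
  have hK : IsCompact (X ∩ {y | L / 2 ≤ ‖y - xs‖}) := hXcomp.inter_right hclosed
  obtain ⟨k0, hk0⟩ := hev.exists
  obtain ⟨z, hz, hmin⟩ := hK.exists_isMinOn ⟨x k0, hx k0, hk0.le⟩
    (hΦcont.mono Set.inter_subset_left)
  have hzne : z ≠ xs := by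
    rintro rfl
    have h2 : L / 2 ≤ ‖z - z‖ := hz.2
    rw [sub_self, norm_zero] at h2
    linarith
  have hc : 0 < Φ z := hΦpos z hz.1 hzne
  have hs : Summable (fun k => α k * Φ z) := by
    refine Summable.of_norm_bounded_eventually_nat hsum ?_
    filter_upwards [hev] with k hk
    rw [Real.norm_of_nonneg (mul_nonneg (hα k) hc.le)]
    exact mul_le_mul_of_nonneg_left (hmin ⟨hx k, hk.le⟩) (hα k)
  have hs' : Summable α := (summable_mul_right_iff hc.ne').1 hs
  exact not_tendsto_atTop_of_tendsto_nhds hs'.hasSum.tendsto_sum_nat hαdiv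
end

section
/- Rank of the doubled incidence block matrix: if G is a finite simple connected non-bipartite graph on M vertices, then the 2M×2|E| matrix T = [[B_−, B_+], [B_+, B_−]] satisfies rank T = 2M − 1; moreover the row vector (𝟙ᵀ | −𝟙ᵀ) ∈ ℝ^{2M} satisfies (𝟙ᵀ | −𝟙ᵀ) T = 0. -/
/-- Rank of the doubled incidence block matrix: if `G` is a finite simple connected
non-bipartite graph on `M` vertices, then `T = [[B₋, B₊], [B₊, B₋]]` satisfies
`rank T = 2M − 1`, and the row vector `(𝟙ᵀ | −𝟙ᵀ)` satisfies `(𝟙ᵀ | −𝟙ᵀ) T = 0`. -/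
theorem stmt_11
    (M : ℕ) (hM : 1 ≤ M)
    (G : SimpleGraph (Fin M)) [DecidableRel G.Adj]
    (hconn : G.Connected)
    -- `G` is not bipartite:
    (hnb : ¬ ∃ S : Set (Fin M), ∀ i j, G.Adj i j → (i ∈ S ↔ j ∉ S))
    (ε : Type) [Fintype ε] [DecidableEq ε]
    (head tail : ε → Fin M)
    (hadj : ∀ e, G.Adj (head e) (tail e))
    -- the edges of the orientation enumerate the edge set of `G` bijectively:
    (hbij : Function.Bijective
      (fun e : ε => (⟨s(head e, tail e), G.mem_edgeSet.mpr (hadj e)⟩ : G.edgeSet))) :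
    let B : Matrix (Fin M) ε ℝ :=
      Matrix.of fun i e => if i = head e then 1 else if i = tail e then -1 else 0
    let Bp : Matrix (Fin M) ε ℝ := Matrix.of fun i e => max (B i e) 0
    let Bm : Matrix (Fin M) ε ℝ := Matrix.of fun i e => max (-(B i e)) 0
    let T : Matrix (Fin M ⊕ Fin M) (ε ⊕ ε) ℝ := Matrix.fromBlocks Bm Bp Bp Bm
    T.rank = 2 * M - 1 ∧
    Matrix.vecMul (Sum.elim (fun _ : Fin M => (1 : ℝ)) fun _ : Fin M => (-1 : ℝ)) T = 0 := by
  intro B Bp Bm T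
  have hBp : ∀ i e, Bp i e = if i = head e then 1 else 0 := by
    intro i e
    simp only [Bp, B, Matrix.of_apply]
    split_ifs <;> norm_num
  have hBm : ∀ i e, Bm i e = if i = tail e then 1 else 0 := by
    intro i e
    have hne := (hadj e).ne
    simp only [Bm, B, Matrix.of_apply]
    by_cases h1 : i = head e
    · have h2 : i ≠ tail e := fun h => hne (h1.symm.trans h)
      simp [h1, hne]
    · simp only [h1, if_false]
      split_ifs <;> norm_num
  have hl : ∀ (w : Fin M ⊕ Fin M → ℝ) (e : ε),
      Matrix.vecMul w T (Sum.inl e) = w (Sum.inl (tail e)) + w (Sum.inr (head e)) := by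
    intro w e
    simp [Matrix.vecMul, dotProduct, T, hBp, hBm]
  have hr : ∀ (w : Fin M ⊕ Fin M → ℝ) (e : ε),
      Matrix.vecMul w T (Sum.inr e) = w (Sum.inl (head e)) + w (Sum.inr (tail e)) := by
    intro w e
    simp [Matrix.vecMul, dotProduct, T, hBp, hBm]
  set v : Fin M ⊕ Fin M → ℝ :=
    Sum.elim (fun _ : Fin M => (1 : ℝ)) fun _ : Fin M => (-1 : ℝ) with hv
  have hv0 : Matrix.vecMul v T = 0 := by
    funext e
    rcases e with e | e
    · rw [hl]; simp [hv]
    · rw [hr]; simp [hv]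
  refine ⟨?_, hv0⟩
  have hker : LinearMap.ker (T.transpose.mulVecLin) = Submodule.span ℝ {v} := by
    apply le_antisymm
    · intro w hw
      rw [LinearMap.mem_ker, Matrix.mulVecLin_apply, Matrix.mulVec_transpose] at hw
      have hA : ∀ i j, G.Adj i j → w (Sum.inl i) + w (Sum.inr j) = 0 := by
        intro i j hij
        obtain ⟨e, he⟩ := hbij.2 ⟨s(i, j), G.mem_edgeSet.mpr hij⟩
        have he' : s(head e, tail e) = s(i, j) := congrArg Subtype.val he
        have h1 := hl w e
        have h2 := hr w e
        rw [hw] at h1 h2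
        simp only [Pi.zero_apply] at h1 h2
        rcases Sym2.eq_iff.mp he' with ⟨a, b⟩ | ⟨a, b⟩
        · rw [a, b] at h2; exact h2.symm
        · rw [a, b] at h1; exact h1.symm
      have hwalk : ∀ i j, G.Walk i j →
          w (Sum.inl i) - w (Sum.inr i) = w (Sum.inl j) - w (Sum.inr j) ∧
          |w (Sum.inl i) + w (Sum.inr i)| = |w (Sum.inl j) + w (Sum.inr j)| := by
        intro i j p
        induction p with
        | nil => exact ⟨rfl, rfl⟩
        | cons h p ih =>
          have h1 := hA _ _ h
          have h2 := hA _ _ h.symm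
          refine ⟨by rw [← ih.1]; linarith, ?_⟩
          rw [← ih.2, ← abs_neg]
          congr 1
          linarith
      have hp : ∀ i, w (Sum.inl i) + w (Sum.inr i) = 0 := by
        intro k
        by_contra hk
        apply hnb
        refine ⟨{i | 0 < w (Sum.inl i) + w (Sum.inr i)}, fun i j hij => ?_⟩
        have h1 := hA _ _ hij
        have h2 := hA _ _ hij.symm
        obtain ⟨p⟩ := hconn.preconnected k j
        have h3 := (hwalk k j p).2
        have h4 : w (Sum.inl j) + w (Sum.inr j) ≠ 0 := by
          intro h
          rw [h, abs_zero, abs_eq_zero] at h3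
          exact hk h3
        simp only [Set.mem_setOf_eq, not_lt]
        constructor
        · intro h; linarith
        · intro h
          have := lt_of_le_of_ne h h4
          linarith
      rw [Submodule.mem_span_singleton]
      let i0 : Fin M := ⟨0, hM⟩
      refine ⟨w (Sum.inl i0), ?_⟩
      have hx : ∀ i, w (Sum.inl i0) = w (Sum.inl i) := by
        intro i
        obtain ⟨p⟩ := hconn.preconnected i0 i
        have h3 := (hwalk i0 i p).1
        have := hp i
        have := hp i0
        linarith
      funext k
      rcases k with i | i
      · simp [hv, hx i]
      · have := hp i
        simp only [hv, Pi.smul_apply, Sum.elim_inr, smul_eq_mul]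
        rw [hx i]; linarith
    · rw [Submodule.span_singleton_le_iff_mem, LinearMap.mem_ker, Matrix.mulVecLin_apply,
        Matrix.mulVec_transpose]
      exact hv0
  have hvne : v ≠ 0 := by
    intro h
    have := congrFun h (Sum.inl ⟨0, hM⟩)
    simp [hv] at this
  have hrn := LinearMap.finrank_range_add_finrank_ker (T.transpose.mulVecLin)
  rw [hker, finrank_span_singleton hvne] at hrn
  simp only [Module.finrank_fintype_fun_eq_card, Fintype.card_sum, Fintype.card_fin] at hrn
  rw [← Matrix.rank_transpose, Matrix.rank]
  omega
end

section
/- Solvability of the noise-design system: let G be a finite simple connected non-bipartite graph on M vertices and T = [[B_−, B_+], [B_+, B_−]] ∈ ℝ^{2M×2|E|}. For any ξ = (ξ¹; ξ²) ∈ ℝ^{2M} with ∑_{i=1}^M ξ¹_i = ∑_{i=1}^M ξ²_i, the linear system T γ = ξ admits at least one solution γ ∈ ℝ^{2|E|}. -/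
/-- Solvability of the noise-design system: for a finite simple connected non-bipartite
graph `G` on `M` vertices with `T = [[B₋, B₊], [B₊, B₋]]`, and any `ξ = (ξ¹; ξ²) ∈ ℝ^{2M}`
with `∑_i ξ¹_i = ∑_i ξ²_i`, the linear system `T γ = ξ` has at least one solution. -/
theorem stmt_12
    (M : ℕ) (hM : 1 ≤ M)
    (G : SimpleGraph (Fin M)) [DecidableRel G.Adj]
    (hconn : G.Connected)
    -- `G` is not bipartite:
    (hnb : ¬ ∃ S : Set (Fin M), ∀ i j, G.Adj i j → (i ∈ S ↔ j ∉ S))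
    (ε : Type) [Fintype ε] [DecidableEq ε]
    (head tail : ε → Fin M)
    (hadj : ∀ e, G.Adj (head e) (tail e))
    -- the edges of the orientation enumerate the edge set of `G` bijectively:
    (hbij : Function.Bijective
      (fun e : ε => (⟨s(head e, tail e), G.mem_edgeSet.mpr (hadj e)⟩ : G.edgeSet))) :
    let B : Matrix (Fin M) ε ℝ :=
      Matrix.of fun i e => if i = head e then 1 else if i = tail e then -1 else 0
    let Bp : Matrix (Fin M) ε ℝ := Matrix.of fun i e => max (B i e) 0
    let Bm : Matrix (Fin M) ε ℝ := Matrix.of fun i e => max (-(B i e)) 0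
    let T : Matrix (Fin M ⊕ Fin M) (ε ⊕ ε) ℝ := Matrix.fromBlocks Bm Bp Bp Bm
    ∀ ξ : Fin M ⊕ Fin M → ℝ,
      (∑ i, ξ (Sum.inl i)) = (∑ i, ξ (Sum.inr i)) →
      ∃ γ : ε ⊕ ε → ℝ, T.mulVec γ = ξ := by
  intro B Bp Bm T ξ hξ
  by_contra hne
  have hnot : ξ ∉ LinearMap.range T.mulVecLin := by
    rintro ⟨γ, hγ⟩
    exact hne ⟨γ, hγ⟩
  obtain ⟨f, hf, hker⟩ := Submodule.exists_le_ker_of_notMem hnot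
  have hfsum : ∀ x : Fin M ⊕ Fin M → ℝ, f x =
      ∑ i, x (Sum.inl i) * f (Pi.single (Sum.inl i) 1)
        + ∑ i, x (Sum.inr i) * f (Pi.single (Sum.inr i) 1) := by
    intro x
    rw [LinearMap.pi_apply_eq_sum_univ f x, Fintype.sum_sum_type]
    have hs : ∀ i : Fin M ⊕ Fin M, (fun j => if i = j then (1:ℝ) else 0) = Pi.single i 1 := by
      intro i
      ext j
      simp [Pi.single_apply, eq_comm]
    simp [hs]
  set a : Fin M → ℝ := fun i => f (Pi.single (Sum.inl i) 1) with ha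
  set c : Fin M → ℝ := fun i => - f (Pi.single (Sum.inr i) 1) with hc
  have hBp : ∀ i e, Bp i e = if i = head e then 1 else 0 := by
    intro i e
    simp only [Bp, B, Matrix.of_apply]
    split_ifs <;> simp
  have hBm : ∀ i e, Bm i e = if i = tail e then 1 else 0 := by
    intro i e
    have hn := (hadj e).ne
    simp only [Bm, B, Matrix.of_apply]
    split_ifs with h1 h2
    · exact absurd (h1.symm.trans h2) hn
    · norm_num
    · norm_num
    · norm_num
  have hcol : ∀ k, f (fun i => T i k) = 0 := by
    intro k
    have : T.mulVecLin (Pi.single k 1) ∈ LinearMap.ker f := hker ⟨_, rfl⟩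
    rw [LinearMap.mem_ker, Matrix.mulVecLin_apply, Matrix.mulVec_single_one] at this
    exact this
  have h1 : ∀ e, a (tail e) = c (head e) := by
    intro e
    have h := hcol (Sum.inl e)
    rw [hfsum] at h
    simp [T, hBp, hBm] at h
    simp only [ha, hc]
    linarith
  have h2 : ∀ e, a (head e) = c (tail e) := by
    intro e
    have h := hcol (Sum.inr e)
    rw [hfsum] at h
    simp [T, hBp, hBm] at h
    simp only [ha, hc]
    linarith
  have hac : ∀ i j, G.Adj i j → a i = c j := by
    intro i j hij
    obtain ⟨e, he⟩ := hbij.2 ⟨s(i, j), G.mem_edgeSet.mpr hij⟩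
    have he' : s(head e, tail e) = s(i, j) := congrArg Subtype.val he
    rcases Sym2.eq_iff.mp he' with ⟨p, q⟩ | ⟨p, q⟩
    · rw [← p, ← q]; exact h2 e
    · rw [← p, ← q]; exact h1 e
  let r : Fin M := ⟨0, hM⟩
  have hall : ∀ v, (a v = a r ∧ c v = c r) ∨ (a v = c r ∧ c v = a r) := by
    intro v
    obtain ⟨w⟩ := hconn.preconnected v r
    generalize r = r' at w
    induction w with
    | nil => exact Or.inl ⟨rfl, rfl⟩
    | cons h p ih =>
      have e1 := hac _ _ h
      have e2 := hac _ _ h.symm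
      rcases ih with ⟨p, q⟩ | ⟨p, q⟩
      · right; exact ⟨e1.trans q, e2.symm.trans p⟩
      · left; exact ⟨e1.trans q, e2.symm.trans p⟩
  have heq : a r = c r := by
    by_contra hne'
    refine hnb ⟨{v | a v = a r}, ?_⟩
    intro i j hij
    have e1 := hac _ _ hij
    simp only [Set.mem_ofPred_eq]
    rw [e1]
    rcases hall j with ⟨p, q⟩ | ⟨p, q⟩
    · rw [p, q]; simp [Ne.symm hne']
    · rw [p, q]; simp [Ne.symm hne']
  apply hf
  rw [hfsum]
  have ea : ∀ i, f (Pi.single (Sum.inl i) 1) = a r := by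
    intro i
    have : a i = a r := by rcases hall i with h | h <;> simp [h, heq]
    exact this
  have ec : ∀ i, f (Pi.single (Sum.inr i) 1) = - a r := by
    intro i
    have : c i = a r := by rcases hall i with h | h <;> simp [h, heq]
    simp only [hc] at this
    linarith
  simp only [ea, ec, ← Finset.sum_mul, hξ]
  ring
end

section
/- Consistency (balance) identity for the privacy construction: with the notation below, ∑_{i ∈ 𝒜^c} ξ¹_i = ∑_{i ∈ 𝒜^c} ξ²_i, where for each i ∈ 𝒜^c, ξ¹_i = (1/(αδ)) [ ∑_{j ∈ 𝒩_{π(i)}} W_{π(i)j}(v_j + α r_{j,π(i)}) − ∑_{j ∈ 𝒩_i} W_{ij} v_{π(j)} ] − ∑_{j ∈ 𝒩_i ∩ 𝒜} r̃_{ji} and ξ²_i = − ∑_{j ∈ 𝒩_i ∩ 𝒜} r̃_{ij}. -/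
theorem aux_nbr {E : Type} [AddCommGroup E] [Module ℝ E] {V : Type} [Fintype V] [DecidableEq V]
    (G : SimpleGraph V) [DecidableRel G.Adj] (i : V) (f : V → E) :
    ∑ j ∈ insert i (G.neighborFinset i), f j
      = f i + ∑ j, (if G.Adj i j then (1:ℝ) else 0) • f j := by
  rw [Finset.sum_insert (by simp)]
  congr 1
  simp only [ite_smul, one_smul, zero_smul]
  rw [← Finset.sum_filter]
  apply Finset.sum_congr _ (fun _ _ => rfl)
  ext j; simp

theorem aux_inter {E : Type} [AddCommGroup E] [Module ℝ E] {V : Type} [Fintype V] [DecidableEq V]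
    (G : SimpleGraph V) [DecidableRel G.Adj] (A : Finset V) (i : V) (hi : i ∉ A) (f : V → E) :
    ∑ j ∈ insert i (G.neighborFinset i) ∩ A, f j
      = ∑ j ∈ A, (if G.Adj i j then (1:ℝ) else 0) • f j := by
  simp only [ite_smul, one_smul, zero_smul]
  rw [← Finset.sum_filter]
  apply Finset.sum_congr _ (fun _ _ => rfl)
  ext j
  simp only [Finset.mem_inter, Finset.mem_insert, SimpleGraph.mem_neighborFinset,
    Finset.mem_filter]
  constructor
  · rintro ⟨rfl | h, h2⟩
    · exact absurd h2 hi
    · exact ⟨h2, h⟩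
  · rintro ⟨h, h2⟩
    exact ⟨Or.inr h2, h⟩


/-- Consistency (balance) identity for the privacy construction:
`∑_{i ∈ 𝒜ᶜ} ξ¹_i = ∑_{i ∈ 𝒜ᶜ} ξ²_i`, where
`ξ¹_i = (1/(αδ)) [ ∑_{j ∈ 𝒩_{π(i)}} W_{π(i)j}(v_j + α r_{j,π(i)}) − ∑_{j ∈ 𝒩_i} W_{ij} v_{π(j)} ]
        − ∑_{j ∈ 𝒩_i ∩ 𝒜} r̃_{ji}` and `ξ²_i = − ∑_{j ∈ 𝒩_i ∩ 𝒜} r̃_{ij}`,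
with `π` the transposition swapping the non-adversarial nodes `I` and `J`. -/
theorem stmt_13
    (d : ℕ) (V : Type) [Fintype V] [DecidableEq V]
    (G : SimpleGraph V) [DecidableRel G.Adj]
    (𝒜 : Finset V) (I J : V) (hI : I ∉ 𝒜) (hJ : J ∉ 𝒜) (hIJ : I ≠ J)
    (δ α : ℝ) (hδ : 0 < δ) (hα : 0 < α)
    (W : Matrix V V ℝ)
    (hWadj : ∀ i j, G.Adj i j → W i j = δ)
    (hWdiag : ∀ i, W i i = 1 - (((insert i (G.neighborFinset i)).card : ℝ) - 1) * δ)
    (hWnadj : ∀ i j, i ≠ j → ¬ G.Adj i j → W i j = 0)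
    (v : V → Euc d)
    (r rt : V → V → Euc d)
    (hrdiag : ∀ i, r i i = 0)
    (hrbal : ∀ i, ∑ j ∈ insert i (G.neighborFinset i), r i j = 0)
    -- `r̃_{ij} = r_{ij}` for `i ∈ 𝒜`:
    (hrt1 : ∀ i ∈ 𝒜, ∀ j, rt i j = r i j)
    -- `r̃_{ij} = (1/α)(v_i − v_{π(i)}) + r_{ij}` for `i ∈ 𝒜ᶜ` and `j ∈ 𝒩_i ∩ 𝒜`:
    (hrt2 : ∀ i ∉ 𝒜, ∀ j ∈ insert i (G.neighborFinset i), j ∈ 𝒜 →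
      rt i j = α⁻¹ • (v i - v (Equiv.swap I J i)) + r i j) :
    ∑ i ∈ 𝒜ᶜ,
        ((α * δ)⁻¹ •
            ((∑ j ∈ insert (Equiv.swap I J i) (G.neighborFinset (Equiv.swap I J i)),
                W (Equiv.swap I J i) j • (v j + α • r j (Equiv.swap I J i))) -
              ∑ j ∈ insert i (G.neighborFinset i), W i j • v (Equiv.swap I J j)) -
          ∑ j ∈ insert i (G.neighborFinset i) ∩ 𝒜, rt j i) =
      ∑ i ∈ 𝒜ᶜ, (- ∑ j ∈ insert i (G.neighborFinset i) ∩ 𝒜, rt i j) := by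
  classical
  set π := Equiv.swap I J with hπ
  set a : V → V → ℝ := fun i j => if G.Adj i j then (1:ℝ) else 0 with ha
  have asymm : ∀ i j, a i j = a j i := fun i j => by simp only [ha, G.adj_comm]
  set u : V → Euc d := fun i => v i - v (π i) with hu
  have hπA : ∀ i, i ∉ 𝒜 ↔ π i ∉ 𝒜 := by
    intro i
    by_cases h1 : i = I
    · subst h1; simp [hπ, hI, hJ]
    by_cases h2 : i = J
    · subst h2; simp [hπ, hI, hJ]
    rw [hπ, Equiv.swap_apply_of_ne_of_ne h1 h2]
  have huA : ∀ i ∈ 𝒜, u i = 0 := by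
    intro i hi
    have h1 : i ≠ I := fun h => hI (h ▸ hi)
    have h2 : i ≠ J := fun h => hJ (h ▸ hi)
    simp only [hu, hπ, Equiv.swap_apply_of_ne_of_ne h1 h2, sub_self]
  have reidx : ∀ f : V → Euc d, ∑ i ∈ 𝒜ᶜ, f (π i) = ∑ i ∈ 𝒜ᶜ, f i := by
    intro f
    refine Finset.sum_equiv π ?_ (fun _ _ => rfl)
    intro i
    rw [Finset.mem_compl, Finset.mem_compl]
    exact hπA i
  have hu0 : ∑ i ∈ 𝒜ᶜ, u i = 0 := by
    simp only [hu, Finset.sum_sub_distrib]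
    rw [reidx v, sub_self]
  have hW : ∀ i (f : V → Euc d), ∑ j ∈ insert i (G.neighborFinset i), W i j • f j
      = f i + δ • ∑ j, a i j • (f j - f i) := by
    intro i f
    rw [aux_nbr, hWdiag]
    have h1 : ((insert i (G.neighborFinset i)).card : ℝ) = 1 + ∑ j, a i j := by
      have := aux_nbr (E := ℝ) G i (fun _ => 1)
      simpa [ha] using this
    have h2 : ∑ j, (if G.Adj i j then (1:ℝ) else 0) • W i j • f j = δ • ∑ j, a i j • f j := by
      rw [Finset.smul_sum]
      refine Finset.sum_congr rfl fun j _ => ?_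
      by_cases h : G.Adj i j
      · simp [ha, h, hWadj i j h]
      · simp [ha, h]
    rw [h1, h2]
    simp only [smul_sub, Finset.sum_sub_distrib, ← Finset.sum_smul]
    module
  have split : ∀ f : V → Euc d, ∑ j, f j = ∑ j ∈ 𝒜, f j + ∑ j ∈ 𝒜ᶜ, f j :=
    fun f => (Finset.sum_add_sum_compl 𝒜 f).symm
  have hr : ∀ i, ∑ j ∈ 𝒜ᶜ, a i j • r i j = - ∑ j ∈ 𝒜, a i j • r i j := by
    intro i
    have := hrbal i
    rw [aux_nbr, hrdiag, zero_add] at this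
    have h2 := split (fun j => a i j • r i j)
    rw [show ∑ j, a i j • r i j = 0 from this] at h2
    exact eq_neg_of_add_eq_zero_right h2.symm
  have hr2 : ∑ i ∈ 𝒜ᶜ, ∑ j ∈ 𝒜ᶜ, a i j • r j i = - ∑ i ∈ 𝒜ᶜ, ∑ j ∈ 𝒜, a i j • r i j := by
    rw [Finset.sum_comm, ← Finset.sum_neg_distrib]
    refine Finset.sum_congr rfl fun i _ => ?_
    rw [← hr]
    exact Finset.sum_congr rfl fun j _ => by rw [asymm]
  have hanti : ∑ i ∈ 𝒜ᶜ, ∑ j ∈ 𝒜ᶜ, a i j • (u j - u i) = 0 := by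
    simp only [smul_sub, Finset.sum_sub_distrib]
    rw [sub_eq_zero, Finset.sum_comm]
    exact Finset.sum_congr rfl fun i _ => Finset.sum_congr rfl fun j _ => by rw [asymm]
  -- right-hand side
  have hR : ∑ i ∈ 𝒜ᶜ, (- ∑ j ∈ insert i (G.neighborFinset i) ∩ 𝒜, rt i j)
      = - (α⁻¹ • ∑ i ∈ 𝒜ᶜ, ∑ j ∈ 𝒜, a i j • u i) - ∑ i ∈ 𝒜ᶜ, ∑ j ∈ 𝒜, a i j • r i j := by
    have : ∀ i ∈ 𝒜ᶜ, (- ∑ j ∈ insert i (G.neighborFinset i) ∩ 𝒜, rt i j)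
        = - (α⁻¹ • ∑ j ∈ 𝒜, a i j • u i) - ∑ j ∈ 𝒜, a i j • r i j := by
      intro i hi
      have hi' := Finset.mem_compl.1 hi
      rw [Finset.sum_congr rfl (g := fun j => α⁻¹ • u i + r i j) (fun j hj => by
        rw [Finset.mem_inter] at hj
        exact hrt2 i hi' j hj.1 hj.2), aux_inter G 𝒜 i hi']
      simp only [smul_add, Finset.sum_add_distrib, ← Finset.sum_smul, ha]
      module
    rw [Finset.sum_congr rfl this, Finset.sum_sub_distrib, Finset.sum_neg_distrib,
      ← Finset.smul_sum]
  rw [hR, Finset.sum_sub_distrib, ← Finset.smul_sum, Finset.sum_sub_distrib,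
    reidx (fun i => ∑ j ∈ insert i (G.neighborFinset i), W i j • (v j + α • r j i)),
    ← Finset.sum_sub_distrib]
  have hT : ∀ i ∈ 𝒜ᶜ, (∑ j ∈ insert i (G.neighborFinset i), W i j • (v j + α • r j i)) -
      ∑ j ∈ insert i (G.neighborFinset i), W i j • v (π j)
      = u i + δ • (∑ j ∈ 𝒜ᶜ, a i j • (u j - u i)) - δ • (∑ j ∈ 𝒜, a i j • u i)
        + (α * δ) • (∑ j ∈ 𝒜, a i j • r j i) + (α * δ) • (∑ j ∈ 𝒜ᶜ, a i j • r j i) := by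
    intro i _
    rw [← Finset.sum_sub_distrib]
    have e : ∀ j, W i j • (v j + α • r j i) - W i j • v (π j) = W i j • (u j + α • r j i) := by
      intro j; simp only [hu]; module
    simp only [e]
    rw [hW i (fun j => u j + α • r j i), hrdiag, split]
    have e1 : ∑ j ∈ 𝒜, a i j • (u j + α • r j i - (u i + α • (0 : Euc d)))
        = α • (∑ j ∈ 𝒜, a i j • r j i) - ∑ j ∈ 𝒜, a i j • u i := by
      rw [Finset.smul_sum, ← Finset.sum_sub_distrib]
      refine Finset.sum_congr rfl fun j hj => ?_
      rw [huA j hj]; module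
    have e2 : ∑ j ∈ 𝒜ᶜ, a i j • (u j + α • r j i - (u i + α • (0 : Euc d)))
        = α • (∑ j ∈ 𝒜ᶜ, a i j • r j i) + ∑ j ∈ 𝒜ᶜ, a i j • (u j - u i) := by
      rw [Finset.smul_sum, ← Finset.sum_add_distrib]
      refine Finset.sum_congr rfl fun j hj => ?_
      module
    rw [e1, e2]
    module
  have hlast : ∑ i ∈ 𝒜ᶜ, ∑ j ∈ insert i (G.neighborFinset i) ∩ 𝒜, rt j i
      = ∑ i ∈ 𝒜ᶜ, ∑ j ∈ 𝒜, a i j • r j i := by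
    refine Finset.sum_congr rfl fun i hi => ?_
    rw [aux_inter G 𝒜 i (Finset.mem_compl.1 hi)]
    exact Finset.sum_congr rfl fun j hj => by rw [hrt1 j hj]
  rw [hlast, Finset.sum_congr rfl hT]
  simp only [Finset.sum_add_distrib, Finset.sum_sub_distrib, ← Finset.smul_sum]
  rw [hu0, hanti, hr2]
  have hα' := hα.ne'
  have hδ' := hδ.ne'
  match_scalars <;> field_simp <;> ring
end
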